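/- Let n ∈ ℕ and let q, a, b, d be nonzero complex numbers such that q^j ≠ 1 for 1 ≤ j ≤ n and d ≠ q^{−j} for 0 ≤ j ≤ n−1. Then: Σ_{k=0}^{n} [ (q^n;q^{−1})_k·(a^{−1};q^{−1})_k·(b^{−1};q^{−1})_k / ( (q^{−1};q^{−1})_k·(d^{−1};q^{−1})_k ) ]·q^{−k} = a^{−n} · Σ_{k=0}^{n} [ (q^{−n};q)_k·(a;q)_k·(d/b;q)_k / ( (q;q)_k·(d;q)_k ) ]·q^{k}. In basic hypergeometric notation this reads ₃φ₂(qⁿ, 1/a, 1/b; 1/d, 0; q^{−1}, q^{−1}) = a^{−n} · ₃φ₂(q^{−n}, a, d/b; d, 0; q, q), where a parameter 0 contributes the factor (0;p)_k = 1. -/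

import Mathlib

/-- q-Pochhammer symbol `(a;p)_k = ∏_{j=0}^{k-1} (1 - a pʲ)` over ℂ. -/
noncomputable def qPochC (a p : ℂ) (k : ℕ) : ℂ := ∏ j ∈ Finset.range k, (1 - a * p ^ j)

lemma qPochC_zero (x p : ℂ) : qPochC x p 0 = 1 := by simp [qPochC]

lemma qPochC_succ (x p : ℂ) (k : ℕ) :
    qPochC x p (k + 1) = qPochC x p k * (1 - x * p ^ k) := by
  simp [qPochC, Finset.prod_range_succ]

lemma qPochC_succ' (x p : ℂ) (k : ℕ) :
    qPochC x p (k + 1) = (1 - x) * qPochC (x * p) p k := by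
  rw [qPochC, Finset.prod_range_succ', mul_comm]
  simp [qPochC, pow_succ', mul_assoc]

lemma qPochC_ne_zero {x p : ℂ} {k : ℕ} (h : ∀ j < k, x * p ^ j ≠ 1) : qPochC x p k ≠ 0 :=
  Finset.prod_ne_zero_iff.2 fun j hj =>
    sub_ne_zero.2 (h j (Finset.mem_range.1 hj)).symm

lemma qPochC_self_ne_zero {q : ℂ} {n k : ℕ} (hqj : ∀ j : ℕ, 1 ≤ j → j ≤ n → q ^ j ≠ 1)
    (hk : k ≤ n) : qPochC q q k ≠ 0 :=
  qPochC_ne_zero fun j hj => by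
    rw [← pow_succ']
    exact hqj _ (by omega) (by omega)

/-- The product `∏_{j<k} (-qʲ)`, relating `q`- and `q⁻¹`-Pochhammer symbols. -/
noncomputable def negPowProd (q : ℂ) (k : ℕ) : ℂ := ∏ j ∈ Finset.range k, (-q ^ j)

lemma negPowProd_succ (q : ℂ) (k : ℕ) :
    negPowProd q (k + 1) = negPowProd q k * -q ^ k := by
  simp [negPowProd, Finset.prod_range_succ]

lemma negPowProd_ne_zero {q : ℂ} (hq : q ≠ 0) (k : ℕ) : negPowProd q k ≠ 0 :=
  Finset.prod_ne_zero_iff.2 fun _ _ => neg_ne_zero.2 (pow_ne_zero _ hq)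

lemma qPochC_inv_inv {x q : ℂ} (hx : x ≠ 0) (hq : q ≠ 0) (k : ℕ) :
    qPochC x⁻¹ q⁻¹ k = qPochC x q k / (x ^ k * negPowProd q k) := by
  induction k with
  | zero => simp [qPochC, negPowProd]
  | succ k ih =>
    have := negPowProd_ne_zero hq k
    rw [qPochC_succ, qPochC_succ, ih, negPowProd_succ, inv_pow]
    field_simp
    ring

/-- The Gaussian binomial coefficient, as a quotient of `q`-Pochhammer symbols. -/
noncomputable def gaussBinom (q : ℂ) (n k : ℕ) : ℂ := qPochC (q ^ n) q⁻¹ k / qPochC q q k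

lemma gaussBinom_zero_right (q : ℂ) (n : ℕ) : gaussBinom q n 0 = 1 := by
  simp [gaussBinom, qPochC]

lemma gaussBinom_self_succ {q : ℂ} (hq : q ≠ 0) (n : ℕ) : gaussBinom q n (n + 1) = 0 := by
  have : q ^ n ≠ 0 := pow_ne_zero _ hq
  simp [gaussBinom, qPochC_succ, this]

lemma gaussBinom_succ_succ {q : ℂ} (hq : q ≠ 0) (n k : ℕ) (h : qPochC q q (k + 1) ≠ 0) :
    gaussBinom q (n + 1) (k + 1)
      = gaussBinom q n (k + 1) + q ^ n / q ^ k * gaussBinom q n k := by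
  have h' := h
  rw [qPochC_succ] at h'
  obtain ⟨h₁, h₂⟩ := mul_ne_zero_iff.1 h'
  have e : q ^ (n + 1) * q⁻¹ = q ^ n := by rw [pow_succ, mul_inv_cancel_right₀ hq]
  rw [gaussBinom, gaussBinom, gaussBinom, qPochC_succ', e, qPochC_succ, qPochC_succ, inv_pow]
  field_simp
  ring

lemma sum_gaussBinom_succ {q : ℂ} (hq : q ≠ 0) (n : ℕ)
    (hqj : ∀ j : ℕ, 1 ≤ j → j ≤ n + 1 → q ^ j ≠ 1) (f : ℕ → ℂ) :
    ∑ k ∈ Finset.range (n + 2), gaussBinom q (n + 1) k * f k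
      = ∑ k ∈ Finset.range (n + 1), gaussBinom q n k * (f k + q ^ n / q ^ k * f (k + 1)) := by
  have h : ∑ k ∈ Finset.range (n + 1), gaussBinom q n k * f k
      = ∑ k ∈ Finset.range (n + 1), gaussBinom q n (k + 1) * f (k + 1)
        + gaussBinom q n 0 * f 0 := by
    rw [← Finset.sum_range_succ' (fun k => gaussBinom q n k * f k), Finset.sum_range_succ _ (n + 1),
      gaussBinom_self_succ hq, zero_mul, add_zero]
  simp only [mul_add, Finset.sum_add_distrib]
  rw [h, Finset.sum_range_succ', gaussBinom_zero_right, gaussBinom_zero_right,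
    add_right_comm, ← Finset.sum_add_distrib]
  congr 1
  refine Finset.sum_congr rfl fun k hk => ?_
  rw [Finset.mem_range] at hk
  rw [gaussBinom_succ_succ hq n k (qPochC_self_ne_zero hqj (by omega))]
  ring

lemma gaussBinom_sum_transformation {q : ℂ} (hq : q ≠ 0) (n : ℕ)
    (hqj : ∀ j : ℕ, 1 ≤ j → j ≤ n → q ^ j ≠ 1) (a b d : ℂ) (ha : a ≠ 0) (hb : b ≠ 0)
    (hd : ∀ j < n, d * q ^ j ≠ 1) :
    a ^ n * ∑ k ∈ Finset.range (n + 1), gaussBinom q n k *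
        (qPochC a q k * qPochC b q k / qPochC d q k * (d / (a * b)) ^ k)
      = ∑ k ∈ Finset.range (n + 1), gaussBinom q n k *
        (negPowProd q k * (q / q ^ n) ^ k *
          (qPochC a q k * qPochC (d / b) q k / qPochC d q k)) := by
  induction n generalizing a b d with
  | zero => simp [gaussBinom, qPochC, negPowProd]
  | succ n ih =>
    have hqj' : ∀ j : ℕ, 1 ≤ j → j ≤ n → q ^ j ≠ 1 := fun j h1 h2 => hqj j h1 (by omega)
    have ih₁ := ih hqj' a b d ha hb fun j hj => hd j (by omega)
    have ih₂ := ih hqj' (a * q) (b * q) (d * q) (mul_ne_zero ha hq) (mul_ne_zero hb hq)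
      fun j hj => by
        rw [mul_assoc, ← pow_succ']
        exact hd _ (by omega)
    have hd1 : 1 - d ≠ 0 := sub_ne_zero.2 (by simpa using (hd 0 (by omega)).symm)
    rw [sum_gaussBinom_succ hq n hqj, sum_gaussBinom_succ hq n hqj]
    have hL : ∑ k ∈ Finset.range (n + 1), gaussBinom q n k *
          (qPochC a q k * qPochC b q k / qPochC d q k * (d / (a * b)) ^ k
            + q ^ n / q ^ k * (qPochC a q (k + 1) * qPochC b q (k + 1) / qPochC d q (k + 1)
              * (d / (a * b)) ^ (k + 1)))
        = ∑ k ∈ Finset.range (n + 1), gaussBinom q n k *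
            (qPochC a q k * qPochC b q k / qPochC d q k * (d / (a * b)) ^ k)
          + q ^ n * ((1 - a) * (1 - b) / (1 - d) * (d / (a * b))) *
            ∑ k ∈ Finset.range (n + 1), gaussBinom q n k *
              (qPochC (a * q) q k * qPochC (b * q) q k / qPochC (d * q) q k
                * (d * q / (a * q * (b * q))) ^ k) := by
      rw [Finset.mul_sum, ← Finset.sum_add_distrib]
      refine Finset.sum_congr rfl fun k _ => ?_
      have e : d * q / (a * q * (b * q)) = d / (a * b) / q := by field_simp
      rw [qPochC_succ' a, qPochC_succ' b, qPochC_succ' d, e, div_pow _ q]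
      simp only [div_eq_mul_inv, mul_inv, pow_succ]
      ring
    have hR : a * ∑ k ∈ Finset.range (n + 1), gaussBinom q n k *
            (negPowProd q k * (q / q ^ n) ^ k *
              (qPochC a q k * qPochC (d / b) q k / qPochC d q k))
          + (d / b * (1 - a) * (1 - b) / (1 - d)) *
            ∑ k ∈ Finset.range (n + 1), gaussBinom q n k *
              (negPowProd q k * (q / q ^ n) ^ k *
              (qPochC (a * q) q k * qPochC (d * q / (b * q)) q k / qPochC (d * q) q k))
        = ∑ k ∈ Finset.range (n + 1), gaussBinom q n k *
          (negPowProd q k * (q / q ^ (n + 1)) ^ k *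
              (qPochC a q k * qPochC (d / b) q k / qPochC d q k)
            + q ^ n / q ^ k * (negPowProd q (k + 1) * (q / q ^ (n + 1)) ^ (k + 1) *
              (qPochC a q (k + 1) * qPochC (d / b) q (k + 1) / qPochC d q (k + 1)))) := by
      rw [Finset.mul_sum, Finset.mul_sum, ← Finset.sum_add_distrib]
      refine Finset.sum_congr rfl fun k hk => ?_
      rw [Finset.mem_range] at hk
      have hdk : qPochC d q k ≠ 0 := qPochC_ne_zero fun j hj => hd j (by omega)
      have hdk' : 1 - d * q ^ k ≠ 0 := sub_ne_zero.2 (hd k (by omega)).symm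
      have hshift : (1 - a) * qPochC (a * q) q k / ((1 - d) * qPochC (d * q) q k)
          = qPochC a q k * (1 - a * q ^ k) / (qPochC d q k * (1 - d * q ^ k)) := by
        rw [← qPochC_succ', ← qPochC_succ', qPochC_succ, qPochC_succ]
      have e₁ : d * q / (b * q) = d / b := by field_simp
      have e₂ : q / q ^ (n + 1) = q / q ^ n / q := by rw [pow_succ, div_div]
      rw [e₁, e₂, qPochC_succ a, qPochC_succ (d / b), qPochC_succ d, negPowProd_succ]
      trans gaussBinom q n k * (negPowProd q k * (q / q ^ n) ^ k * qPochC (d / b) q k) *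
        (a * (qPochC a q k / qPochC d q k) + d / b * (1 - b) *
          ((1 - a) * qPochC (a * q) q k / ((1 - d) * qPochC (d * q) q k)))
      · simp only [div_eq_mul_inv, mul_inv]
        ring
      · rw [hshift, pow_succ (q / q ^ n / q), div_pow (q / q ^ n) q]
        generalize (q / q ^ n) ^ k = r
        field_simp
        ring
    rw [hL, ← hR, ← ih₁, ← ih₂, mul_pow]
    field_simp
    ring

/-- The ₃φ₂ transformation with a vanishing lower parameter,
`₃φ₂(qⁿ, 1/a, 1/b; 1/d, 0; q⁻¹, q⁻¹) = a⁻ⁿ ₃φ₂(q⁻ⁿ, a, d/b; d, 0; q, q)`,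
written out as an identity of terminating sums (a parameter `0` contributes
the factor `(0;p)_k = 1`). -/
theorem phi32_transformation_degenerate
    (n : ℕ) (q a b d : ℂ)
    (hq : q ≠ 0) (ha : a ≠ 0) (hb : b ≠ 0) (hd : d ≠ 0)
    (hqj : ∀ j : ℕ, 1 ≤ j → j ≤ n → q ^ j ≠ 1)
    (hdj : ∀ j : ℕ, j < n → d ≠ (q ^ j)⁻¹) :
    (∑ k ∈ Finset.range (n + 1),
        (qPochC (q ^ n) q⁻¹ k * qPochC a⁻¹ q⁻¹ k * qPochC b⁻¹ q⁻¹ k) /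
          (qPochC q⁻¹ q⁻¹ k * qPochC d⁻¹ q⁻¹ k) * q⁻¹ ^ k)
      = a ^ (-(n : ℤ)) *
        ∑ k ∈ Finset.range (n + 1),
          (qPochC (q ^ (-(n : ℤ))) q k * qPochC a q k * qPochC (d / b) q k) /
            (qPochC q q k * qPochC d q k) * q ^ k := by
  have hd' : ∀ j < n, d * q ^ j ≠ 1 := fun j hj h => hdj j hj (eq_inv_of_mul_eq_one_left h)
  have key := gaussBinom_sum_transformation hq n hqj a b d ha hb hd'
  have hqn : q ^ n ≠ 0 := pow_ne_zero _ hq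
  rw [zpow_neg, zpow_neg, zpow_natCast, zpow_natCast, eq_inv_mul_iff_mul_eq₀ (pow_ne_zero _ ha)]
  convert key using 2
  · refine Finset.sum_congr rfl fun k hk => ?_
    rw [Finset.mem_range] at hk
    have hQ : qPochC q q k ≠ 0 := qPochC_self_ne_zero hqj (by omega)
    have hD : qPochC d q k ≠ 0 := qPochC_ne_zero fun j hj => hd' j (by omega)
    have hE := negPowProd_ne_zero hq k
    rw [gaussBinom, qPochC_inv_inv ha hq, qPochC_inv_inv hb hq, qPochC_inv_inv hq hq,
      qPochC_inv_inv hd hq, inv_pow, div_pow, mul_pow]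
    field_simp
  · rename_i k hk
    have hE := negPowProd_ne_zero hq k
    have h := qPochC_inv_inv (inv_ne_zero hqn) hq k
    rw [inv_inv] at h
    rw [gaussBinom, h, inv_pow, div_pow]
    field_simp
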